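/- Let N be a finite ground set with |N| = n ≥ 5 and let f : 2^N → ℝ be subadditive with f(∅) = 0. Define g(S) := f(S) − ∑_{i ∈ S} f({i}). Suppose there exist distinct elements i, j, k, l ∈ N with g({i,j}) ≤ g({j,k}) ≤ g({k,l}) ≤ 0 and (2^{n−3} − n + 2)·g({k,l}) < g({i,j}). Then the ℓ¹-divergence Δ_f is not supermodular: there exist 𝒦 ⊆ 2^N ∖ 𝒦₀ and distinct S, Z ∈ (2^N ∖ 𝒦₀) ∖ 𝒦 such that Δ_f(𝒦 ∪ {S, Z}) − Δ_f(𝒦 ∪ {S}) < Δ_f(𝒦 ∪ {Z}) − Δ_f(𝒦). -/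

import Mathlib

open Finset

/-- The minimal information family: the empty set, the ground set, and all singletons. -/
def K0 (N : Type*) [Fintype N] : Set (Finset N) :=
  {∅, (Finset.univ : Finset N)} ∪ {S : Finset N | ∃ i : N, S = {i}}

/-- A set function is subadditive if `f (S ∪ T) ≤ f S + f T` for disjoint `S`, `T`. -/
def SubadditiveSF {N : Type*} [DecidableEq N] (f : Finset N → ℝ) : Prop :=
  ∀ S T : Finset N, Disjoint S T → f (S ∪ T) ≤ f S + f T

/-- A set function is monotone if `S ⊆ T` implies `f S ≤ f T`. -/
def MonotoneSF {N : Type*} (f : Finset N → ℝ) : Prop :=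
  ∀ S T : Finset N, S ⊆ T → f S ≤ f T

/-- Elementwise monotonicity: `f S ≤ f (S ∪ {i})`. -/
def MonotoneStep {N : Type*} [DecidableEq N] (f : Finset N → ℝ) : Prop :=
  ∀ (S : Finset N) (i : N), i ∉ S → f S ≤ f (insert i S)

/-- Upper completion: minimum of `∑ f Sᵢ` over families of pairwise disjoint nonempty
sets `Sᵢ ∈ K` partitioning `S`; it is `0` at `∅`. -/
noncomputable def upperC {N : Type*} [DecidableEq N] (f : Finset N → ℝ)
    (K : Set (Finset N)) (S : Finset N) : ℝ :=
  if S = ∅ then 0 else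
    sInf {x : ℝ | ∃ P : Finset (Finset N),
      (∀ T ∈ P, T ∈ K) ∧ (∀ T ∈ P, T ≠ ∅) ∧
      (∀ T₁ ∈ P, ∀ T₂ ∈ P, T₁ ≠ T₂ → Disjoint T₁ T₂) ∧
      P.sup id = S ∧ x = ∑ T ∈ P, f T}

/-- Lower completion: maximum of `f T - upperC f K (T \ S)` over `T ∈ K` with `S ⊆ T`. -/
noncomputable def lowerC {N : Type*} [DecidableEq N] (f : Finset N → ℝ)
    (K : Set (Finset N)) (S : Finset N) : ℝ :=
  sSup {x : ℝ | ∃ T ∈ K, S ⊆ T ∧ x = f T - upperC f K (T \ S)}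

/-- The ℓ¹-divergence of `f` with revealed family `K ⊆ 2^N \ K0`. -/
noncomputable def ldiv {N : Type*} [Fintype N] [DecidableEq N] (f : Finset N → ℝ)
    (K : Set (Finset N)) : ℝ :=
  ∑ T : Finset N, (upperC f (K0 N ∪ K) T - lowerC f (K0 N ∪ K) T)

/-- SAM upper completion: minimum of `∑ f Sᵢ` over nonempty finite families
`S₁, …, S_k ∈ K` covering `S`. -/
noncomputable def samUpper {N : Type*} [DecidableEq N] (f : Finset N → ℝ)
    (K : Set (Finset N)) (S : Finset N) : ℝ :=
  sInf {x : ℝ | ∃ (k : ℕ) (Ss : Fin (k + 1) → Finset N),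
    (∀ i, Ss i ∈ K) ∧ S ⊆ Finset.univ.sup Ss ∧ x = ∑ i, f (Ss i)}

/-- SAM lower completion. -/
noncomputable def samLower {N : Type*} [DecidableEq N] (f : Finset N → ℝ)
    (K : Set (Finset N)) (S : Finset N) : ℝ :=
  max (sSup {x : ℝ | ∃ Y ∈ K, Y ⊆ S ∧ x = f Y})
      (sSup {x : ℝ | ∃ X ∈ K, S ⊆ X ∧ x = f X - samUpper f K (X \ S)})

/-- The SAM ℓ¹-divergence. -/
noncomputable def samDiv {N : Type*} [Fintype N] [DecidableEq N] (f : Finset N → ℝ)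
    (K : Set (Finset N)) : ℝ :=
  ∑ T : Finset N, (samUpper f (K0 N ∪ K) T - samLower f (K0 N ∪ K) T)

/-- `{(α i, T i)}` is a fractional cover of `S`. -/
def IsFracCover {N : Type*} [DecidableEq N] (S : Finset N) (k : ℕ)
    (α : Fin k → ℝ) (T : Fin k → Finset N) : Prop :=
  (∀ i, 0 < α i) ∧
  ∀ j ∈ S, (1 : ℝ) ≤ ∑ i ∈ Finset.univ.filter (fun i => j ∈ T i), α i

/-- A set function is fractionally subadditive. -/
def FracSubadditive {N : Type*} [DecidableEq N] (f : Finset N → ℝ) : Prop :=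
  ∀ (S : Finset N) (k : ℕ) (α : Fin k → ℝ) (T : Fin k → Finset N),
    IsFracCover S k α T → f S ≤ ∑ i, α i * f (T i)

/-- XOS: pointwise maximum of finitely many nonnegative additive set functions. -/
def IsXOS {N : Type*} (f : Finset N → ℝ) : Prop :=
  ∃ (s : ℕ) (a : Fin (s + 1) → N → ℝ),
    (∀ i j, 0 ≤ a i j) ∧
    ∀ S : Finset N, f S = Finset.univ.sup' Finset.univ_nonempty (fun i => ∑ j ∈ S, a i j)

/-- XOS upper completion: infimum of `∑ αᵢ f Tᵢ` over fractional covers of `S`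
using sets from `K`. -/
noncomputable def xosUpper {N : Type*} [DecidableEq N] (f : Finset N → ℝ)
    (K : Set (Finset N)) (S : Finset N) : ℝ :=
  sInf {x : ℝ | ∃ (k : ℕ) (α : Fin k → ℝ) (T : Fin k → Finset N),
    IsFracCover S k α T ∧ (∀ i, T i ∈ K) ∧ x = ∑ i, α i * f (T i)}

theorem singleton_mem_K0 {N : Type*} [Fintype N] (x : N) : {x} ∈ K0 N := Or.inr ⟨x, rfl⟩

theorem univ_mem_K0 {N : Type*} [Fintype N] : Finset.univ ∈ K0 N := Or.inl (Or.inr rfl)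

/-- `P` is a partition of `S` into nonempty members of `K`. -/
def IsPartitionIn {N : Type*} [DecidableEq N] (K : Set (Finset N)) (S : Finset N)
    (P : Finset (Finset N)) : Prop :=
  (∀ T ∈ P, T ∈ K) ∧ (∀ T ∈ P, T ≠ ∅) ∧
    (∀ T₁ ∈ P, ∀ T₂ ∈ P, T₁ ≠ T₂ → Disjoint T₁ T₂) ∧ P.sup id = S

section Completion

variable {N : Type*} [DecidableEq N]

theorem IsPartitionIn.sum_weight {K : Set (Finset N)} {S : Finset N} {P : Finset (Finset N)}
    (h : IsPartitionIn K S P) (y : N → ℝ) : ∑ T ∈ P, ∑ x ∈ T, y x = ∑ x ∈ S, y x := by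
  obtain ⟨-, -, h3, rfl⟩ := h
  rw [Finset.sup_eq_biUnion, Finset.sum_biUnion]
  · rfl
  · intro A hA B hB hAB
    exact h3 A hA B hB hAB

theorem IsPartitionIn.subset {K : Set (Finset N)} {S : Finset N} {P : Finset (Finset N)}
    (h : IsPartitionIn K S P) {T : Finset N} (hT : T ∈ P) : T ⊆ S := by
  rw [← h.2.2.2]
  exact Finset.le_sup (f := id) hT

/-- A disjoint family of members of `K` inside `S` extends by singletons to a partition of `S`. -/
theorem IsPartitionIn.exists_extend {K : Set (Finset N)} (hK : ∀ x : N, {x} ∈ K)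
    {S U : Finset N} {P : Finset (Finset N)} (h : IsPartitionIn K U P) (hU : U ⊆ S)
    (f : Finset N → ℝ) :
    ∃ Q, IsPartitionIn K S Q ∧ ∑ T ∈ Q, f T = ∑ T ∈ P, f T + ∑ x ∈ S \ U, f {x} := by
  have hd : Disjoint P ((S \ U).image fun x => ({x} : Finset N)) := by
    rw [Finset.disjoint_left]
    intro T hT hT'
    obtain ⟨x, hx, rfl⟩ := Finset.mem_image.1 hT'
    have := h.subset hT (Finset.mem_singleton_self x)
    exact (Finset.mem_sdiff.1 hx).2 this
  refine ⟨P ∪ (S \ U).image fun x => {x}, ⟨?_, ?_, ?_, ?_⟩, ?_⟩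
  · intro T hT
    rcases Finset.mem_union.1 hT with hT | hT
    · exact h.1 T hT
    · obtain ⟨x, -, rfl⟩ := Finset.mem_image.1 hT
      exact hK x
  · intro T hT
    rcases Finset.mem_union.1 hT with hT | hT
    · exact h.2.1 T hT
    · obtain ⟨x, -, rfl⟩ := Finset.mem_image.1 hT
      exact Finset.singleton_ne_empty x
  · intro A hA B hB hAB
    rcases Finset.mem_union.1 hA with hA | hA <;> rcases Finset.mem_union.1 hB with hB | hB
    · exact h.2.2.1 A hA B hB hAB
    · obtain ⟨x, hx, rfl⟩ := Finset.mem_image.1 hB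
      rw [Finset.disjoint_singleton_right]
      exact fun hxA => (Finset.mem_sdiff.1 hx).2 (h.subset hA hxA)
    · obtain ⟨x, hx, rfl⟩ := Finset.mem_image.1 hA
      rw [Finset.disjoint_singleton_left]
      exact fun hxB => (Finset.mem_sdiff.1 hx).2 (h.subset hB hxB)
    · obtain ⟨x, -, rfl⟩ := Finset.mem_image.1 hA
      obtain ⟨x', -, rfl⟩ := Finset.mem_image.1 hB
      rw [Finset.disjoint_singleton]
      rintro rfl
      exact hAB rfl
  · rw [Finset.sup_union, h.2.2.2, Finset.sup_image]
    ext x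
    simp only [Finset.sup_eq_union, Finset.mem_union, Finset.mem_sup, Function.comp, id,
      Finset.mem_singleton, Finset.mem_sdiff]
    constructor
    · rintro (hx | ⟨w, hw, rfl⟩)
      · exact hU hx
      · exact hw.1
    · intro hx
      by_cases hxU : x ∈ U
      · exact Or.inl hxU
      · exact Or.inr ⟨x, ⟨hx, hxU⟩, rfl⟩
  · rw [Finset.sum_union hd, Finset.sum_image]
    intro x _ x' _ hxx
    exact Finset.singleton_injective hxx

theorem isPartitionIn_empty (K : Set (Finset N)) : IsPartitionIn K ∅ ∅ := by
  simp [IsPartitionIn]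

theorem isPartitionIn_singleton {K : Set (Finset N)} {X : Finset N} (hX : X ∈ K) (h0 : X ≠ ∅) :
    IsPartitionIn K X {X} := by
  simp_all [IsPartitionIn]

theorem isPartitionIn_pair {K : Set (Finset N)} {X Y : Finset N} (hX : X ∈ K) (hX0 : X ≠ ∅)
    (hY : Y ∈ K) (hY0 : Y ≠ ∅) (hd : Disjoint X Y) : IsPartitionIn K (X ∪ Y) {X, Y} := by
  refine ⟨by simp [hX, hY], by simp [hX0, hY0], ?_, by simp⟩
  simp [hd, hd.symm]

theorem upperC_empty (f : Finset N → ℝ) (K : Set (Finset N)) : upperC f K ∅ = 0 := by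
  simp [upperC]

theorem SubadditiveSF.le_sum {f : Finset N → ℝ} (hf : SubadditiveSF f) (hf0 : f ∅ = 0)
    (P : Finset (Finset N)) (hP : ∀ T₁ ∈ P, ∀ T₂ ∈ P, T₁ ≠ T₂ → Disjoint T₁ T₂) :
    f (P.sup id) ≤ ∑ T ∈ P, f T := by
  induction P using Finset.induction_on with
  | empty => simp [hf0]
  | insert A P hA ih =>
    rw [Finset.sup_insert, Finset.sum_insert hA]
    have hd : Disjoint A (P.sup id) := by
      rw [Finset.disjoint_sup_right]
      intro B hB
      refine hP A (Finset.mem_insert_self A P) B (Finset.mem_insert_of_mem hB) ?_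
      rintro rfl
      exact hA hB
    have h1 := hf A (P.sup id) hd
    have h2 := ih fun B hB C hC => hP B (Finset.mem_insert_of_mem hB) C
      (Finset.mem_insert_of_mem hC)
    simp only [id, Finset.sup_eq_union] at h1 h2 ⊢
    linarith

theorem SubadditiveSF.antitone {f : Finset N → ℝ} (hf : SubadditiveSF f) (hf0 : f ∅ = 0)
    (h1 : ∀ x, f {x} = 0) {S T : Finset N} (h : S ⊆ T) : f T ≤ f S := by
  have key : ∀ U : Finset N, f U ≤ 0 := by
    intro U
    induction U using Finset.induction_on with
    | empty => exact hf0.le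
    | insert x U hx ih =>
      have := hf {x} U (Finset.disjoint_singleton_left.2 hx)
      rw [h1, ← Finset.insert_eq] at this
      linarith
  have := hf S (T \ S) Finset.disjoint_sdiff
  rw [Finset.union_sdiff_of_subset h] at this
  linarith [key (T \ S)]

variable [Fintype N]

theorem finite_partition_values (f : Finset N → ℝ) (K : Set (Finset N)) (S : Finset N) :
    {x : ℝ | ∃ P : Finset (Finset N),
      (∀ T ∈ P, T ∈ K) ∧ (∀ T ∈ P, T ≠ ∅) ∧
      (∀ T₁ ∈ P, ∀ T₂ ∈ P, T₁ ≠ T₂ → Disjoint T₁ T₂) ∧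
      P.sup id = S ∧ x = ∑ T ∈ P, f T}.Finite := by
  refine (Set.finite_range fun P : Finset (Finset N) => ∑ T ∈ P, f T).subset ?_
  rintro x ⟨P, -, -, -, -, rfl⟩
  exact ⟨P, rfl⟩

theorem upperC_le {f : Finset N → ℝ} {K : Set (Finset N)} {S : Finset N} {P : Finset (Finset N)}
    (h : IsPartitionIn K S P) : upperC f K S ≤ ∑ T ∈ P, f T := by
  unfold upperC
  split_ifs with hS
  · have hP : P = ∅ := by
      rw [Finset.eq_empty_iff_forall_notMem]
      intro T hT
      exact h.2.1 T hT (Finset.subset_empty.1 (hS ▸ h.subset hT))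
    simp [hP]
  · exact csInf_le (finite_partition_values f K S).bddBelow
      ⟨P, h.1, h.2.1, h.2.2.1, h.2.2.2, rfl⟩

theorem exists_upperC_eq {K : Set (Finset N)} (hK : ∀ x : N, {x} ∈ K) (f : Finset N → ℝ)
    (S : Finset N) : ∃ P, IsPartitionIn K S P ∧ upperC f K S = ∑ T ∈ P, f T := by
  by_cases hS : S = ∅
  · subst hS
    exact ⟨∅, isPartitionIn_empty K, by simp [upperC]⟩
  · obtain ⟨Q, hQ, -⟩ := (isPartitionIn_empty K).exists_extend hK (Finset.empty_subset S) f
    have hmem := fun hne => Set.Nonempty.csInf_mem hne (finite_partition_values f K S)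
    obtain ⟨P, h1, h2, h3, h4, h5⟩ :=
      hmem ⟨∑ T ∈ Q, f T, Q, hQ.1, hQ.2.1, hQ.2.2.1, hQ.2.2.2, rfl⟩
    refine ⟨P, ⟨h1, h2, h3, h4⟩, ?_⟩
    rw [← h5, upperC, if_neg hS]

theorem le_upperC_of_weight {K : Set (Finset N)} (hK : ∀ x : N, {x} ∈ K) {f : Finset N → ℝ}
    {S : Finset N} (y : N → ℝ) (hy : ∀ X ∈ K, X ⊆ S → ∑ x ∈ X, y x ≤ f X) :
    ∑ x ∈ S, y x ≤ upperC f K S := by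
  obtain ⟨P, hP, hu⟩ := exists_upperC_eq hK f S
  rw [hu, ← hP.sum_weight y]
  exact Finset.sum_le_sum fun X hX => hy X (hP.1 X hX) (hP.subset hX)

theorem upperC_add_weight_le {K : Set (Finset N)} (hK : ∀ x : N, {x} ∈ K)
    {f g : Finset N → ℝ} (y : N → ℝ) (h : ∀ X, f X = g X + ∑ x ∈ X, y x) (S : Finset N) :
    upperC f K S ≤ upperC g K S + ∑ x ∈ S, y x := by
  obtain ⟨P, hP, hu⟩ := exists_upperC_eq hK g S
  rw [hu, ← hP.sum_weight y, ← Finset.sum_add_distrib]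
  refine (upperC_le hP).trans (le_of_eq ?_)
  exact Finset.sum_congr rfl fun X _ => h X

theorem upperC_add_weight {K : Set (Finset N)} (hK : ∀ x : N, {x} ∈ K)
    {f g : Finset N → ℝ} (y : N → ℝ) (h : ∀ X, f X = g X + ∑ x ∈ X, y x) (S : Finset N) :
    upperC f K S = upperC g K S + ∑ x ∈ S, y x := by
  refine le_antisymm (upperC_add_weight_le hK y h S) ?_
  have := upperC_add_weight_le (f := g) (g := f) hK (fun x => -y x)
    (fun X => by rw [h X, Finset.sum_neg_distrib]; ring) S
  rw [Finset.sum_neg_distrib] at this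
  linarith

theorem finite_lower_values (f : Finset N → ℝ) (K : Set (Finset N)) (S : Finset N) :
    {x : ℝ | ∃ T ∈ K, S ⊆ T ∧ x = f T - upperC f K (T \ S)}.Finite := by
  refine (Set.finite_range fun T : Finset N => f T - upperC f K (T \ S)).subset ?_
  rintro x ⟨T, -, -, rfl⟩
  exact ⟨T, rfl⟩

theorem le_lowerC {f : Finset N → ℝ} {K : Set (Finset N)} {S T : Finset N} (hT : T ∈ K)
    (hST : S ⊆ T) : f T - upperC f K (T \ S) ≤ lowerC f K S :=
  le_csSup (finite_lower_values f K S).bddAbove ⟨T, hT, hST, rfl⟩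

theorem lowerC_le {f : Finset N → ℝ} {K : Set (Finset N)} (hK : Finset.univ ∈ K) {S : Finset N}
    {c : ℝ} (h : ∀ T ∈ K, S ⊆ T → f T - upperC f K (T \ S) ≤ c) : lowerC f K S ≤ c := by
  refine csSup_le ⟨_, Finset.univ, hK, Finset.subset_univ S, rfl⟩ ?_
  rintro x ⟨T, hT, hST, rfl⟩
  exact h T hT hST

theorem lowerC_add_weight {K : Set (Finset N)} (hK : ∀ x : N, {x} ∈ K) (hu : Finset.univ ∈ K)
    {f g : Finset N → ℝ} (y : N → ℝ) (h : ∀ X, f X = g X + ∑ x ∈ X, y x) (S : Finset N) :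
    lowerC f K S = lowerC g K S + ∑ x ∈ S, y x := by
  have key : ∀ T, S ⊆ T → f T - upperC f K (T \ S) =
      g T - upperC g K (T \ S) + ∑ x ∈ S, y x := by
    intro T hT
    rw [upperC_add_weight hK y h, h T, ← Finset.sum_sdiff hT]
    ring
  apply le_antisymm
  · refine lowerC_le hu fun T hT hST => ?_
    rw [key T hST]
    linarith [le_lowerC (f := g) hT hST]
  · have : lowerC g K S ≤ lowerC f K S - ∑ x ∈ S, y x := by
      refine lowerC_le hu fun T hT hST => ?_
      linarith [le_lowerC (f := f) hT hST, key T hST]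
    linarith

theorem ldiv_add_weight {f g : Finset N → ℝ} (y : N → ℝ) (h : ∀ X, f X = g X + ∑ x ∈ X, y x)
    (K : Set (Finset N)) : ldiv f K = ldiv g K := by
  refine Finset.sum_congr rfl fun T _ => ?_
  rw [upperC_add_weight (fun x => Or.inl (singleton_mem_K0 x)) y h,
    lowerC_add_weight (fun x => Or.inl (singleton_mem_K0 x)) (Or.inl univ_mem_K0) y h]
  ring

theorem le_upperC {K : Set (Finset N)} (hK : ∀ x : N, {x} ∈ K) {f : Finset N → ℝ}
    (hf : SubadditiveSF f) (hf0 : f ∅ = 0) (S : Finset N) : f S ≤ upperC f K S := by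
  obtain ⟨P, hP, hu⟩ := exists_upperC_eq hK f S
  rw [hu]
  have := hf.le_sum hf0 P hP.2.2.1
  rwa [hP.2.2.2] at this

theorem upperC_eq_of_mem {K : Set (Finset N)} (hK : ∀ x : N, {x} ∈ K) {f : Finset N → ℝ}
    (hf : SubadditiveSF f) (hf0 : f ∅ = 0) {S : Finset N} (hS : S ∈ K) : upperC f K S = f S := by
  refine le_antisymm ?_ (le_upperC hK hf hf0 S)
  by_cases h0 : S = ∅
  · rw [h0, upperC_empty, hf0]
  · simpa using upperC_le (f := f) (isPartitionIn_singleton hS h0)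

theorem lowerC_eq_of_mem {K : Set (Finset N)} (hK : ∀ x : N, {x} ∈ K) (hu : Finset.univ ∈ K)
    {f : Finset N → ℝ} (hf : SubadditiveSF f) (hf0 : f ∅ = 0) {S : Finset N} (hS : S ∈ K) :
    lowerC f K S = f S := by
  apply le_antisymm
  · refine lowerC_le hu fun T _ hST => ?_
    have h1 := hf S (T \ S) Finset.disjoint_sdiff
    rw [Finset.union_sdiff_of_subset hST] at h1
    linarith [le_upperC hK hf hf0 (T \ S)]
  · have := le_lowerC (f := f) hS (Finset.Subset.refl S)
    rwa [Finset.sdiff_self, upperC_empty, sub_zero] at this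

theorem upperC_le_of_subset {K : Set (Finset N)} (hK : ∀ x : N, {x} ∈ K) {f : Finset N → ℝ}
    (h1 : ∀ x, f {x} = 0) {X S : Finset N} (hX : X ∈ K) (h0 : X ≠ ∅) (hXS : X ⊆ S) :
    upperC f K S ≤ f X := by
  obtain ⟨Q, hQ, hs⟩ := (isPartitionIn_singleton hX h0).exists_extend hK hXS f
  simpa [hs, h1] using upperC_le (f := f) hQ

theorem upperC_le_of_disjoint {K : Set (Finset N)} (hK : ∀ x : N, {x} ∈ K) {f : Finset N → ℝ}
    (h1 : ∀ x, f {x} = 0) {X Y S : Finset N} (hX : X ∈ K) (hX0 : X ≠ ∅) (hY : Y ∈ K)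
    (hY0 : Y ≠ ∅) (hd : Disjoint X Y) (hXS : X ⊆ S) (hYS : Y ⊆ S) :
    upperC f K S ≤ f X + f Y := by
  obtain ⟨Q, hQ, hs⟩ := (isPartitionIn_pair hX hX0 hY hY0 hd).exists_extend hK
    (Finset.union_subset hXS hYS) f
  have hne : X ≠ Y := by
    rintro rfl
    exact hX0 (Finset.disjoint_self_iff_empty X |>.1 hd)
  simpa [hs, h1, Finset.sum_pair hne] using upperC_le (f := f) hQ

theorem upperC_nonpos {K : Set (Finset N)} (hK : ∀ x : N, {x} ∈ K) {f : Finset N → ℝ}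
    (h1 : ∀ x, f {x} = 0) (S : Finset N) : upperC f K S ≤ 0 := by
  obtain ⟨Q, hQ, hs⟩ := (isPartitionIn_empty K).exists_extend hK (Finset.empty_subset S) f
  simpa [hs, h1] using upperC_le (f := f) hQ

end Completion

section Path

variable {N : Type*} [Fintype N] [DecidableEq N]

/-- A subadditive set function vanishing on singletons, with a path `i - j - k - l` of pairs of
increasing nonpositive values. -/
structure IsMonotonePath (f : Finset N → ℝ) (i j k l : N) : Prop where
  sub : SubadditiveSF f
  zero : f ∅ = 0
  single : ∀ x, f {x} = 0
  hij : i ≠ j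
  hik : i ≠ k
  hil : i ≠ l
  hjk : j ≠ k
  hjl : j ≠ l
  hkl : k ≠ l
  le_left : f {i, j} ≤ f {j, k}
  le_right : f {j, k} ≤ f {k, l}
  nonpos : f {k, l} ≤ 0

/-- The minimal information together with `{j, k}` and `{k, l}ᶜ`, and optionally `{i, j}` and
`{k, l}`. -/
def pathFamily (i j k l : N) (s z : Bool) : Set (Finset N) :=
  {X | X = ∅ ∨ X = Finset.univ ∨ (∃ x, X = {x}) ∨ X = {j, k} ∨ X = {k, l}ᶜ ∨
    (s = true ∧ X = {i, j}) ∨ (z = true ∧ X = {k, l})}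

/-- The minimum weight of a matching in `T` by the revealed pairs of the path. -/
noncomputable def pathMatching (f : Finset N → ℝ) (i j k l : N) (s z : Bool) (T : Finset N) : ℝ :=
  if s = true ∧ i ∈ T ∧ j ∈ T then
    f {i, j} + if z = true ∧ k ∈ T ∧ l ∈ T then f {k, l} else 0
  else if j ∈ T ∧ k ∈ T then f {j, k}
  else if z = true ∧ k ∈ T ∧ l ∈ T then f {k, l} else 0

variable {f : Finset N → ℝ} {i j k l : N} {s z : Bool} {T : Finset N}

theorem singleton_mem_pathFamily (x : N) : {x} ∈ pathFamily i j k l s z :=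
  Or.inr (Or.inr (Or.inl ⟨x, rfl⟩))

theorem univ_mem_pathFamily : Finset.univ ∈ pathFamily i j k l s z := Or.inr (Or.inl rfl)

theorem jk_mem_pathFamily : {j, k} ∈ pathFamily i j k l s z :=
  Or.inr (Or.inr (Or.inr (Or.inl rfl)))

theorem compl_mem_pathFamily : {k, l}ᶜ ∈ pathFamily i j k l s z :=
  Or.inr (Or.inr (Or.inr (Or.inr (Or.inl rfl))))

theorem ij_mem_pathFamily (hs : s = true) : {i, j} ∈ pathFamily i j k l s z :=
  Or.inr (Or.inr (Or.inr (Or.inr (Or.inr (Or.inl ⟨hs, rfl⟩)))))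

theorem kl_mem_pathFamily (hz : z = true) : {k, l} ∈ pathFamily i j k l s z :=
  Or.inr (Or.inr (Or.inr (Or.inr (Or.inr (Or.inr ⟨hz, rfl⟩)))))

theorem mem_pathFamily_of_subset_pair {x y : N} (hT : T ⊆ {x, y})
    (hxy : {x, y} ∈ pathFamily i j k l s z) : T ∈ pathFamily i j k l s z := by
  have h : T = ∅ ∨ T = {x} ∨ T = {y} ∨ T = {x, y} := by
    have h' : (T : Set N) ⊆ {x, y} := fun w hw => by simpa using hT hw
    exact_mod_cast Set.subset_pair_iff_eq.1 h'
  rcases h with rfl | rfl | rfl | rfl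
  · exact Or.inl rfl
  · exact singleton_mem_pathFamily x
  · exact singleton_mem_pathFamily y
  · exact hxy

theorem IsMonotonePath.compl_le (h : IsMonotonePath f i j k l) : f {k, l}ᶜ ≤ f {i, j} := by
  refine h.sub.antitone h.zero h.single ?_
  intro x hx
  have := h.hik; have := h.hil; have := h.hjk; have := h.hjl
  simp only [Finset.mem_insert, Finset.mem_singleton, Finset.mem_compl] at hx ⊢
  rcases hx with rfl | rfl <;> simp_all

theorem IsMonotonePath.univ_le (h : IsMonotonePath f i j k l) :
    f Finset.univ ≤ f {k, l}ᶜ + f {k, l} := by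
  have := h.sub {k, l}ᶜ {k, l} disjoint_compl_left
  rwa [Finset.union_comm, Finset.union_compl] at this

theorem le_upperC_of_two_weights {K : Set (Finset N)} (hK : ∀ x : N, {x} ∈ K) (p q : ℝ)
    (h : ∀ X ∈ K, X ⊆ T → (if j ∈ X then p else 0) + (if k ∈ X then q else 0) ≤ f X) :
    (if j ∈ T then p else 0) + (if k ∈ T then q else 0) ≤ upperC f K T := by
  have key : ∀ X : Finset N, ∑ x ∈ X, ((if j = x then p else 0) + (if k = x then q else 0)) =
      (if j ∈ X then p else 0) + (if k ∈ X then q else 0) := by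
    intro X
    rw [Finset.sum_add_distrib, Finset.sum_ite_eq, Finset.sum_ite_eq]
  rw [← key]
  refine le_upperC_of_weight hK _ fun X hX hXT => ?_
  rw [key]
  exact h X hX hXT

theorem IsMonotonePath.le_upperC (h : IsMonotonePath f i j k l) {p q : ℝ} (hp : p ≤ 0)
    (hq : q ≤ 0) (hT : T ≠ Finset.univ) (hW : {k, l}ᶜ ⊆ T → p ≤ f {k, l}ᶜ)
    (hpq : j ∈ T → k ∈ T → p + q ≤ f {j, k})
    (hs : s = true → i ∈ T → j ∈ T → p ≤ f {i, j})
    (hz : z = true → k ∈ T → l ∈ T → q ≤ f {k, l}) :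
    (if j ∈ T then p else 0) + (if k ∈ T then q else 0) ≤
      upperC f (pathFamily i j k l s z) T := by
  refine le_upperC_of_two_weights singleton_mem_pathFamily p q ?_
  rintro X (rfl | rfl | ⟨x, rfl⟩ | rfl | rfl | ⟨hs', rfl⟩ | ⟨hz', rfl⟩) hX
  · simp [h.zero]
  · exact absurd (Finset.univ_subset_iff.1 hX) hT
  · rw [h.single]
    split_ifs <;> linarith
  · have h1 := hpq (hX (by simp)) (hX (by simp))
    simpa [h.hjk, h.hjk.symm] using h1
  · have h1 := hW hX
    simpa [h.hjk, h.hjl] using h1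
  · have h1 := hs hs' (hX (by simp)) (hX (by simp))
    simpa [h.hik.symm, h.hjk.symm] using h1
  · have h1 := hz hz' (hX (by simp)) (hX (by simp))
    simpa [h.hjk, h.hjl] using h1

theorem IsMonotonePath.upperC_eq (h : IsMonotonePath f i j k l) (hW : ¬ {k, l}ᶜ ⊆ T) :
    upperC f (pathFamily i j k l s z) T = pathMatching f i j k l s z T := by
  have hT : T ≠ Finset.univ := by
    rintro rfl
    exact hW (Finset.subset_univ _)
  have hW' : ∀ p, {k, l}ᶜ ⊆ T → p ≤ f {k, l}ᶜ := fun p h' => absurd h' hW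
  have hd : Disjoint ({i, j} : Finset N) {k, l} := by
    simp [h.hik.symm, h.hil.symm, h.hjk.symm, h.hjl.symm]
  have := h.le_left; have := h.le_right; have := h.nonpos
  have pair : ∀ {x y : N}, x ∈ T → y ∈ T → ({x, y} : Finset N) ⊆ T := by
    intro x y hx hy
    simp [Finset.insert_subset_iff, hx, hy]
  unfold pathMatching
  apply le_antisymm
  · split_ifs with h1 h2 h2 h3
    · exact upperC_le_of_disjoint singleton_mem_pathFamily h.single (ij_mem_pathFamily h1.1)
        (by simp) (kl_mem_pathFamily h2.1) (by simp) hd (pair h1.2.1 h1.2.2) (pair h2.2.1 h2.2.2)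
    · rw [add_zero]
      exact upperC_le_of_subset singleton_mem_pathFamily h.single (ij_mem_pathFamily h1.1)
        (by simp) (pair h1.2.1 h1.2.2)
    · exact upperC_le_of_subset singleton_mem_pathFamily h.single jk_mem_pathFamily
        (by simp) (pair h2.1 h2.2)
    · exact upperC_le_of_subset singleton_mem_pathFamily h.single (kl_mem_pathFamily h3.1)
        (by simp) (pair h3.2.1 h3.2.2)
    · exact upperC_nonpos singleton_mem_pathFamily h.single T
  · split_ifs with h1 h2 h2 h3
    · have := h.le_upperC (s := s) (z := z) (p := f {i, j}) (q := f {k, l}) (by linarith)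
        (by linarith) hT (hW' _) (fun _ _ => by linarith) (fun _ _ _ => le_rfl)
        (fun _ _ _ => le_rfl)
      simpa [h1.2.2, h2.2.1] using this
    · have := h.le_upperC (s := s) (z := z) (p := f {i, j}) (q := 0) (by linarith)
        le_rfl hT (hW' _) (fun _ _ => by linarith) (fun _ _ _ => le_rfl)
        (fun x y w => absurd ⟨x, y, w⟩ h2)
      simpa [h1.2.2] using this
    · have := h.le_upperC (s := s) (z := z) (p := 0) (q := f {j, k}) le_rfl
        (by linarith) hT (hW' _) (fun _ _ => by linarith) (fun x y w => absurd ⟨x, y, w⟩ h1)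
        (fun _ _ _ => by linarith)
      simpa [h2.2] using this
    · have := h.le_upperC (s := s) (z := z) (p := 0) (q := f {k, l}) le_rfl
        (by linarith) hT (hW' _) (fun x y => absurd ⟨x, y⟩ h2)
        (fun x y w => absurd ⟨x, y, w⟩ h1) (fun _ _ _ => by linarith)
      simpa [h3.2.1] using this
    · have := h.le_upperC (s := s) (z := z) (p := 0) (q := 0) le_rfl
        le_rfl hT (hW' _) (fun x y => absurd ⟨x, y⟩ h2)
        (fun x y w => absurd ⟨x, y, w⟩ h1) (fun x y w => absurd ⟨x, y, w⟩ h3)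
      simpa using this

theorem IsMonotonePath.upperC_eq_compl (h : IsMonotonePath f i j k l) (hW : {k, l}ᶜ ⊆ T)
    (hT : T ≠ Finset.univ) : upperC f (pathFamily i j k l s z) T = f {k, l}ᶜ := by
  have hjW : j ∈ ({k, l}ᶜ : Finset N) := by simp [h.hjk, h.hjl]
  have := h.le_left; have := h.le_right; have := h.nonpos; have := h.compl_le
  apply le_antisymm
  · exact upperC_le_of_subset singleton_mem_pathFamily h.single compl_mem_pathFamily
      (Finset.ne_empty_of_mem hjW) hW
  · have := h.le_upperC (s := s) (z := z) (p := f {k, l}ᶜ) (q := 0) (by linarith)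
        le_rfl hT (fun _ => le_rfl) (fun _ _ => by linarith) (fun _ _ _ => by linarith)
        (fun _ hk hl => by
          refine absurd (Finset.eq_univ_of_forall fun x => ?_) hT
          by_cases hx : x ∈ ({k, l} : Finset N)
          · simp only [Finset.mem_insert, Finset.mem_singleton] at hx
            rcases hx with rfl | rfl <;> assumption
          · exact hW (Finset.mem_compl.2 hx))
    simpa [hW hjW] using this

theorem lowerC_eq_max (hT : T ∉ pathFamily i j k l s z) (hW : T ⊆ {k, l}ᶜ) :
    lowerC f (pathFamily i j k l s z) T =
      max (f Finset.univ - upperC f (pathFamily i j k l s z) Tᶜ)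
        (f {k, l}ᶜ - upperC f (pathFamily i j k l s z) ({k, l}ᶜ \ T)) := by
  apply le_antisymm
  · refine lowerC_le univ_mem_pathFamily fun X hX hTX => ?_
    have hX' := hX
    rcases hX with rfl | rfl | ⟨x, rfl⟩ | rfl | rfl | ⟨-, rfl⟩ | ⟨-, rfl⟩
    · exact absurd (Or.inl (Finset.subset_empty.1 hTX)) hT
    · rw [← Finset.compl_eq_univ_sdiff]
      exact le_max_left _ _
    · exact absurd (mem_pathFamily_of_subset_pair (x := x) (y := x) (by simpa using hTX)
        (by simpa using hX')) hT
    · exact absurd (mem_pathFamily_of_subset_pair hTX hX') hT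
    · exact le_max_right _ _
    · exact absurd (mem_pathFamily_of_subset_pair hTX hX') hT
    · exact absurd (mem_pathFamily_of_subset_pair hTX hX') hT
  · refine max_le ?_ (le_lowerC compl_mem_pathFamily hW)
    rw [Finset.compl_eq_univ_sdiff T]
    exact le_lowerC univ_mem_pathFamily (Finset.subset_univ T)

theorem lowerC_eq_of_not_subset (hT : T ∉ pathFamily i j k l s z) (hW : ¬ T ⊆ {k, l}ᶜ) :
    lowerC f (pathFamily i j k l s z) T =
      f Finset.univ - upperC f (pathFamily i j k l s z) Tᶜ := by
  apply le_antisymm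
  · refine lowerC_le univ_mem_pathFamily fun X hX hTX => ?_
    have hX' := hX
    rcases hX with rfl | rfl | ⟨x, rfl⟩ | rfl | rfl | ⟨-, rfl⟩ | ⟨-, rfl⟩
    · exact absurd (Or.inl (Finset.subset_empty.1 hTX)) hT
    · rw [← Finset.compl_eq_univ_sdiff]
    · exact absurd (mem_pathFamily_of_subset_pair (x := x) (y := x) (by simpa using hTX)
        (by simpa using hX')) hT
    · exact absurd (mem_pathFamily_of_subset_pair hTX hX') hT
    · exact absurd hTX hW
    · exact absurd (mem_pathFamily_of_subset_pair hTX hX') hT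
    · exact absurd (mem_pathFamily_of_subset_pair hTX hX') hT
  · rw [Finset.compl_eq_univ_sdiff T]
    exact le_lowerC univ_mem_pathFamily (Finset.subset_univ T)

/-- The gap between the upper and the lower completion at `T`. -/
noncomputable def pathGap (f : Finset N → ℝ) (i j k l : N) (T : Finset N) (s z : Bool) : ℝ :=
  upperC f (pathFamily i j k l s z) T - lowerC f (pathFamily i j k l s z) T

theorem K0_union_eq_pathFamily : K0 N ∪ (({{j, k}, {k, l}ᶜ} : Set (Finset N)) ∪
    {X | (s = true ∧ X = {i, j}) ∨ (z = true ∧ X = {k, l})}) = pathFamily i j k l s z := by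
  ext X
  simp only [K0, pathFamily, Set.mem_union, Set.mem_insert_iff, Set.mem_singleton_iff,
    Set.mem_ofPred_eq, or_assoc]

theorem ldiv_eq_sum_pathGap (f : Finset N → ℝ) (i j k l : N) (s z : Bool) :
    ldiv f (({{j, k}, {k, l}ᶜ} : Set (Finset N)) ∪
      {X | (s = true ∧ X = {i, j}) ∨ (z = true ∧ X = {k, l})}) =
        ∑ T, pathGap f i j k l T s z := by
  rw [ldiv, K0_union_eq_pathFamily]
  rfl

theorem IsMonotonePath.pathGap_eq_zero (h : IsMonotonePath f i j k l)
    (hT : T ∈ pathFamily i j k l s z) : pathGap f i j k l T s z = 0 := by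
  rw [pathGap, upperC_eq_of_mem singleton_mem_pathFamily h.sub h.zero hT,
    lowerC_eq_of_mem singleton_mem_pathFamily univ_mem_pathFamily h.sub h.zero hT, sub_self]

theorem IsMonotonePath.pathGap_left (h : IsMonotonePath f i j k l) {m : N} (hmi : m ≠ i)
    (hmj : m ≠ j) (hmk : m ≠ k) (hml : m ≠ l) :
    pathGap f i j k l {i, j} false false = pathGap f i j k l {i, j} false true := by
  have hmW : m ∈ ({k, l}ᶜ : Finset N) := by simp [hmk, hml]
  have hmij : m ∉ ({i, j} : Finset N) := by simp [hmi, hmj]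
  have hsub : ({i, j} : Finset N) ⊆ {k, l}ᶜ := by
    simp [Finset.insert_subset_iff, h.hik, h.hil, h.hjk, h.hjl]
  have hi : i ∈ ({i, j} : Finset N) := by simp
  have hj : j ∈ ({i, j} : Finset N) := by simp
  have hmem : ∀ z, ({i, j} : Finset N) ∉ pathFamily i j k l false z := by
    rintro z (h' | h' | ⟨x, h'⟩ | h' | h' | ⟨hs, -⟩ | ⟨-, h'⟩)
    · simp at h'
    · exact hmij (h' ▸ Finset.mem_univ m)
    · rw [h', Finset.mem_singleton] at hi hj
      exact h.hij (hi.trans hj.symm)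
    · rw [h'] at hi
      simp [h.hij, h.hik] at hi
    · exact hmij (h' ▸ hmW)
    · simp at hs
    · rw [h'] at hi
      simp [h.hik, h.hil] at hi
  have e1 : ¬ ({k, l}ᶜ : Finset N) ⊆ {i, j} := fun h' => hmij (h' hmW)
  have e2 : ¬ ({k, l}ᶜ : Finset N) ⊆ {i, j}ᶜ := fun h' => by
    simpa using h' (hsub hi)
  have e3 : ¬ ({k, l}ᶜ : Finset N) ⊆ {k, l}ᶜ \ {i, j} := fun h' => by
    simpa using h' (hsub hi)
  have hle := h.univ_le
  have hkl := h.nonpos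
  simp only [pathGap, lowerC_eq_max (hmem _) hsub, h.upperC_eq e1, h.upperC_eq e2,
    h.upperC_eq e3, pathMatching]
  generalize f {k, l}ᶜ = w at hle ⊢
  simp [h.hik.symm, h.hil.symm, h.hjk.symm, h.hjl.symm]
  rw [max_eq_right (by linarith), max_eq_right (by linarith)]

theorem IsMonotonePath.pathGap_right (h : IsMonotonePath f i j k l) :
    pathGap f i j k l {k, l} true false = pathGap f i j k l {k, l} false false := by
  have hiW : i ∈ ({k, l}ᶜ : Finset N) := by simp [h.hik, h.hil]
  have hikl : i ∉ ({k, l} : Finset N) := by simp [h.hik, h.hil]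
  have hk : k ∈ ({k, l} : Finset N) := by simp
  have hl : l ∈ ({k, l} : Finset N) := by simp
  have hmem : ∀ s, ({k, l} : Finset N) ∉ pathFamily i j k l s false := by
    rintro z (h' | h' | ⟨x, h'⟩ | h' | h' | ⟨-, h'⟩ | ⟨hz, -⟩)
    · simp at h'
    · exact hikl (h' ▸ Finset.mem_univ i)
    · rw [h', Finset.mem_singleton] at hk hl
      exact h.hkl (hk.trans hl.symm)
    · rw [h'] at hl
      simp [h.hjl.symm, h.hkl.symm] at hl
    · exact hikl (h' ▸ hiW)
    · rw [h'] at hk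
      simp [h.hik.symm, h.hjk.symm] at hk
    · simp at hz
  have e1 : ¬ ({k, l}ᶜ : Finset N) ⊆ {k, l} := fun h' => hikl (h' hiW)
  have e2 : ¬ ({k, l} : Finset N) ⊆ {k, l}ᶜ := fun h' => by simpa using h' hk
  have e3 : ({k, l}ᶜ : Finset N) ≠ Finset.univ := fun h' => by
    have := h' ▸ Finset.mem_univ k
    simp at this
  simp only [pathGap, lowerC_eq_of_not_subset (hmem _) e2, h.upperC_eq e1,
    h.upperC_eq_compl (Finset.Subset.refl _) e3, pathMatching]
  simp [h.hik, h.hil, h.hjk, h.hjl]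

theorem not_mem_pathFamily_of_true (hT : T ∉ pathFamily i j k l true true) (s z : Bool) :
    T ∉ pathFamily i j k l s z := by
  simp only [pathFamily, Set.mem_ofPred_eq] at hT ⊢
  tauto

theorem IsMonotonePath.pathGap_add_le_of_subset (h : IsMonotonePath f i j k l)
    (hT : T ∉ pathFamily i j k l true true) (hW : T ⊆ {k, l}ᶜ) :
    pathGap f i j k l T true true + pathGap f i j k l T false false ≤
      pathGap f i j k l T true false + pathGap f i j k l T false true := by
  have hT0 : T.Nonempty := by
    rw [Finset.nonempty_iff_ne_empty]
    rintro rfl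
    exact hT (Or.inl rfl)
  obtain ⟨w, hw⟩ := hT0
  have e1 : ¬ {k, l}ᶜ ⊆ T := fun h' => by
    rw [hW.antisymm h'] at hT
    exact hT compl_mem_pathFamily
  have e2 : ¬ {k, l}ᶜ ⊆ Tᶜ := fun h' => by simpa [hw] using h' (hW hw)
  have e3 : ¬ {k, l}ᶜ ⊆ {k, l}ᶜ \ T := fun h' => by simpa [hw] using h' (hW hw)
  have hk : k ∉ T := fun h' => by simpa using hW h'
  have hl : l ∉ T := fun h' => by simpa using hW h'
  have h1 := h.univ_le
  have h2 := h.le_left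
  have h3 := h.le_right
  have h4 := h.nonpos
  simp only [pathGap, lowerC_eq_max (not_mem_pathFamily_of_true hT _ _) hW, h.upperC_eq e1,
    h.upperC_eq e2, h.upperC_eq e3, pathMatching]
  generalize f {k, l}ᶜ = w at h1 ⊢
  by_cases hi : i ∈ T <;> by_cases hj : j ∈ T <;>
    simp [hk, hl, hi, hj, h.hik, h.hil, h.hjk, h.hjl]
  · linarith
  · right
    linarith

theorem IsMonotonePath.pathGap_add_le_of_not_subset (h : IsMonotonePath f i j k l)
    (hT : T ∉ pathFamily i j k l true true) (hW : ¬ T ⊆ {k, l}ᶜ) :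
    pathGap f i j k l T true true + pathGap f i j k l T false false ≤
      pathGap f i j k l T true false + pathGap f i j k l T false true +
        if i ∈ T ∧ j ∈ T ∧ k ∈ T ∧ l ∈ T then f {k, l} else 0 := by
  have e2 : ¬ {k, l}ᶜ ⊆ Tᶜ := fun h' =>
    hT (mem_pathFamily_of_subset_pair (Finset.compl_subset_compl.1 h') (kl_mem_pathFamily rfl))
  have hkl : k ∈ T ∨ l ∈ T := by
    by_contra! hc
    refine hW fun x hx => ?_
    simp only [Finset.mem_compl, Finset.mem_insert, Finset.mem_singleton]
    rintro (rfl | rfl)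
    · exact hc.1 hx
    · exact hc.2 hx
  have hTu : T ≠ Finset.univ := by
    rintro rfl
    exact hT univ_mem_pathFamily
  have h4 := h.nonpos
  by_cases e1 : {k, l}ᶜ ⊆ T
  · have : ¬ (k ∈ T ∧ l ∈ T) := by
      rintro ⟨hk, hl⟩
      refine hTu (Finset.eq_univ_of_forall fun x => ?_)
      by_cases hx : x ∈ ({k, l} : Finset N)
      · simp only [Finset.mem_insert, Finset.mem_singleton] at hx
        rcases hx with rfl | rfl <;> assumption
      · exact e1 (Finset.mem_compl.2 hx)
    have hi : i ∈ T := e1 (by simp [h.hik, h.hil])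
    have hj : j ∈ T := e1 (by simp [h.hjk, h.hjl])
    simp only [pathGap, lowerC_eq_of_not_subset (not_mem_pathFamily_of_true hT _ _) hW,
      h.upperC_eq_compl e1 hTu, h.upperC_eq e2, pathMatching]
    simp only [hi, hj, this, Finset.mem_compl]
    simp
    linarith
  · simp only [pathGap, lowerC_eq_of_not_subset (not_mem_pathFamily_of_true hT _ _) hW,
      h.upperC_eq e1, h.upperC_eq e2, pathMatching]
    by_cases hi : i ∈ T <;> by_cases hj : j ∈ T <;> by_cases hk : k ∈ T <;>
      by_cases hl : l ∈ T <;> simp [hi, hj, hk, hl] <;> grind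

theorem IsMonotonePath.pathGap_add_le (h : IsMonotonePath f i j k l) {m : N} (hmi : m ≠ i)
    (hmj : m ≠ j) (hmk : m ≠ k) (hml : m ≠ l) (T : Finset N) :
    pathGap f i j k l T true true + pathGap f i j k l T false false ≤
      pathGap f i j k l T true false + pathGap f i j k l T false true := by
  by_cases hT : T ∈ pathFamily i j k l true true
  · rw [h.pathGap_eq_zero hT]
    by_cases hT' : T ∈ pathFamily i j k l false false
    · have hmono : ∀ s z, T ∈ pathFamily i j k l s z := by
        intro s z
        simp only [pathFamily, Set.mem_ofPred_eq] at hT' ⊢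
        tauto
      simp only [h.pathGap_eq_zero (hmono _ _), le_refl]
    · have : T = {i, j} ∨ T = {k, l} := by
        simp only [pathFamily, Set.mem_ofPred_eq] at hT hT'
        tauto
      rcases this with rfl | rfl
      · rw [h.pathGap_eq_zero (s := true) (ij_mem_pathFamily rfl), h.pathGap_left hmi hmj hmk hml]
      · rw [h.pathGap_eq_zero (z := true) (kl_mem_pathFamily rfl), h.pathGap_right, add_comm]
  · by_cases hW : T ⊆ {k, l}ᶜ
    · exact h.pathGap_add_le_of_subset hT hW
    · refine (h.pathGap_add_le_of_not_subset hT hW).trans ?_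
      have := h.nonpos
      split_ifs <;> linarith

theorem IsMonotonePath.pathGap_add_lt (h : IsMonotonePath f i j k l) (hneg : f {k, l} < 0) {m : N}
    (hmi : m ≠ i) (hmj : m ≠ j) (hmk : m ≠ k) (hml : m ≠ l) :
    pathGap f i j k l {i, j, k, l} true true + pathGap f i j k l {i, j, k, l} false false <
      pathGap f i j k l {i, j, k, l} true false + pathGap f i j k l {i, j, k, l} false true := by
  obtain ⟨T, hT⟩ : ∃ T : Finset N, T = {i, j, k, l} := ⟨_, rfl⟩
  rw [← hT]
  have hi : i ∈ T := by simp [hT]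
  have hj : j ∈ T := by simp [hT]
  have hk : k ∈ T := by simp [hT]
  have hl : l ∈ T := by simp [hT]
  have hm : m ∉ T := by simp [hT, hmi, hmj, hmk, hml]
  have hmem : T ∉ pathFamily i j k l true true := by
    rintro (h' | h' | ⟨x, h'⟩ | h' | h' | ⟨-, h'⟩ | ⟨-, h'⟩)
    · simp [h'] at hi
    · simp [h'] at hm
    · rw [h', Finset.mem_singleton] at hi hj
      exact h.hij (hi.trans hj.symm)
    · simp [h', h.hij, h.hik] at hi
    · simp [h'] at hk
    · simp [h', h.hik.symm, h.hjk.symm] at hk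
    · simp [h', h.hik, h.hil] at hi
  have hW : ¬ T ⊆ {k, l}ᶜ := fun h' => by simpa using h' hk
  have := h.pathGap_add_le_of_not_subset hmem hW
  rw [if_pos ⟨hi, hj, hk, hl⟩] at this
  linarith

end Path

/-- for `n ≥ 5`, under the stated condition on pair values, the
ℓ¹-divergence is not supermodular. -/
theorem divergence_not_supermodular {N : Type*} [Fintype N] [DecidableEq N]
    (n : ℕ) (hn : Fintype.card N = n) (h5 : 5 ≤ n)
    (f : Finset N → ℝ) (hf0 : f ∅ = 0) (hsub : SubadditiveSF f)
    (g : Finset N → ℝ) (hgdef : ∀ S : Finset N, g S = f S - ∑ i ∈ S, f {i})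
    (i j k l : N)
    (hij : i ≠ j) (hik : i ≠ k) (hil : i ≠ l)
    (hjk : j ≠ k) (hjl : j ≠ l) (hkl : k ≠ l)
    (h1 : g {i, j} ≤ g {j, k}) (h2 : g {j, k} ≤ g {k, l}) (h3 : g {k, l} ≤ 0)
    (h4 : ((2 : ℝ) ^ (n - 3) - n + 2) * g {k, l} < g {i, j}) :
    ∃ (K : Set (Finset N)) (S Z : Finset N),
      K ⊆ (K0 N)ᶜ ∧ S ∉ K0 N ∧ Z ∉ K0 N ∧ S ∉ K ∧ Z ∉ K ∧ S ≠ Z ∧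
      ldiv f (K ∪ {S, Z}) - ldiv f (K ∪ {S}) <
        ldiv f (K ∪ {Z}) - ldiv f K := by
  have hg : ∀ S, f S = g S + ∑ x ∈ S, f {x} := fun S => by rw [hgdef]; ring
  have h : IsMonotonePath g i j k l := by
    refine ⟨fun S T hST => ?_, ?_, fun x => ?_, hij, hik, hil, hjk, hjl, hkl, h1, h2, h3⟩
    · have := hsub S T hST
      rw [hg, hg S, hg T, Finset.sum_union hST] at this
      linarith
    · simp [hgdef, hf0]
    · simp [hgdef]
  have hneg : g {k, l} < 0 := by
    rcases h3.lt_or_eq with h' | h'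
    · exact h'
    · rw [h', mul_zero] at h4
      linarith
  obtain ⟨m, hm⟩ : ∃ m, m ∉ ({i, j, k, l} : Finset N) := by
    by_contra! hc
    have hcard := Finset.card_le_four (a := i) (b := j) (c := k) (d := l)
    rw [Finset.eq_univ_of_forall hc, Finset.card_univ] at hcard
    omega
  simp only [Finset.mem_insert, Finset.mem_singleton, not_or] at hm
  obtain ⟨hmi, hmj, hmk, hml⟩ := hm
  have hK0 : ∀ X : Finset N, ∀ x ∈ X, ∀ y ∈ X, x ≠ y → ∀ w ∉ X, X ∉ K0 N := by
    rintro X x hx y hy hxy w hw ((rfl | rfl) | ⟨v, rfl⟩)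
    · simp at hx
    · simp at hw
    · simp only [Finset.mem_singleton] at hx hy
      exact hxy (hx.trans hy.symm)
  have hiW : i ∈ ({k, l}ᶜ : Finset N) := by simp [hik, hil]
  have hjW : j ∈ ({k, l}ᶜ : Finset N) := by simp [hjk, hjl]
  have hmW : m ∈ ({k, l}ᶜ : Finset N) := by simp [hmk, hml]
  have hkW : k ∉ ({k, l}ᶜ : Finset N) := by simp
  have hfam : ∀ s z, ldiv f (({{j, k}, {k, l}ᶜ} : Set (Finset N)) ∪
      {X | (s = true ∧ X = {i, j}) ∨ (z = true ∧ X = {k, l})}) =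
        ∑ T, pathGap g i j k l T s z := by
    intro s z
    rw [ldiv_add_weight (fun x => f {x}) hg, ldiv_eq_sum_pathGap]
  refine ⟨{{j, k}, {k, l}ᶜ}, {i, j}, {k, l}, ?_, ?_, ?_, ?_, ?_, ?_, ?_⟩
  · rintro X (rfl | rfl)
    · exact hK0 _ j (by simp) k (by simp) hjk i (by simp [hij, hik])
    · exact hK0 _ i hiW j hjW hij k hkW
  · exact hK0 _ i (by simp) j (by simp) hij k (by simp [hik.symm, hjk.symm])
  · exact hK0 _ k (by simp) l (by simp) hkl i (by simp [hik, hil])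
  · rintro (h' | h')
    · have : i ∈ ({j, k} : Finset N) := h' ▸ Finset.mem_insert_self i {j}
      simp [hij, hik] at this
    · rw [← h'] at hmW
      simp [hmi, hmj] at hmW
  · rintro (h' | h')
    · have : j ∈ ({k, l} : Finset N) := h' ▸ Finset.mem_insert_self j {k}
      simp [hjk, hjl] at this
    · exact hkW (h' ▸ Finset.mem_insert_self k {l})
  · intro h'
    have : i ∈ ({k, l} : Finset N) := h' ▸ Finset.mem_insert_self i {j}
    simp [hik, hil] at this
  · have e11 := hfam true true
    have e10 := hfam true false
    have e01 := hfam false true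
    have e00 := hfam false false
    have s11 : {X : Finset N | (true = true ∧ X = {i, j}) ∨ (true = true ∧ X = {k, l})} =
        {{i, j}, {k, l}} := by ext; simp
    have s10 : {X : Finset N | (true = true ∧ X = {i, j}) ∨ (false = true ∧ X = {k, l})} =
        {{i, j}} := by ext; simp
    have s01 : {X : Finset N | (false = true ∧ X = {i, j}) ∨ (true = true ∧ X = {k, l})} =
        {{k, l}} := by ext; simp
    have s00 : {X : Finset N | (false = true ∧ X = {i, j}) ∨ (false = true ∧ X = {k, l})} =
        ∅ := by ext; simp
    rw [s11] at e11
    rw [s10] at e10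
    rw [s01] at e01
    rw [s00, Set.union_empty] at e00
    have hlt := Finset.sum_lt_sum
      (fun T (_ : T ∈ Finset.univ) => h.pathGap_add_le hmi hmj hmk hml T)
      ⟨_, Finset.mem_univ _, h.pathGap_add_lt hneg hmi hmj hmk hml⟩
    rw [Finset.sum_add_distrib, Finset.sum_add_distrib] at hlt
    rw [e11, e10, e01, e00]
    linarith
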